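/- arXiv:2012.07067 — 2 statements merged into one kernel-verified Lean document; each statement's English description precedes it below -/
import Mathlib

section
/- Let p be a prime, n ≥ 1, and let k = (k_1, …, k_d) be an index of depth d ≥ 1. Let α be the set of distinct cyclic rotations of k. Then the rational number Σ_{k' ∈ α} Σ_{s=0}^{k'_1 − 2} H_{p−1}(k'_1 − s, k'_2, …, k'_d, s+1) − Σ_{k' ∈ α} H_{p−1}(k'_1 + 1, k'_2, …, k'_d) − Σ_{k' ∈ α} Σ_{l=0}^{n−1} p^l · [ H_{p−1}(k'_2, …, k'_d, k'_1, l+1) + H_{p−1}(k'_2, …, k'_d, k'_1 + l + 1) ] lies in p^n ℤ_{(p)}. (For k' with k'_1 = 1 the inner sum over s is empty.) -/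
open Finset

/-- Multiple harmonic sum `H_m(k)` with strict inequalities `m ≥ m₁ > ⋯ > m_d > 0`. -/
noncomputable def H : ℕ → List ℕ → ℚ
  | _, [] => 1
  | m, k :: ks => ∑ i ∈ Finset.Icc 1 m, (1 / (i : ℚ) ^ k) * H (i - 1) ks

/-- The set of distinct cyclic rotations of an index. -/
def cycOrbit (k : List ℕ) : Finset (List ℕ) :=
  (Finset.range k.length).image (fun j => k.rotate j)

/-- Multiple harmonic sum weighted by a function of (last variable minus one). -/
noncomputable def GG : ℕ → List ℕ → (ℕ → ℚ) → ℚ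
  | m, [], f => f m
  | m, k :: ks, f => ∑ i ∈ Finset.Icc 1 m, (1 / (i : ℚ) ^ k) * GG (i - 1) ks f

theorem GG_append (m : ℕ) (ks ls : List ℕ) (f : ℕ → ℚ) :
    GG m (ks ++ ls) f = GG m ks (fun m => GG m ls f) := by
  induction ks generalizing m with
  | nil => rfl
  | cons k ks ih => simp [GG, ih]

theorem H_append (m : ℕ) (ks ls : List ℕ) :
    H m (ks ++ ls) = GG m ks (fun m => H m ls) := by
  induction ks generalizing m with
  | nil => rfl
  | cons k ks ih => simp [GG, H, ih]

theorem GG_congr (m : ℕ) (ks : List ℕ) (f g : ℕ → ℚ) (h : ∀ x ≤ m, f x = g x) :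
    GG m ks f = GG m ks g := by
  induction ks generalizing m with
  | nil => exact h m le_rfl
  | cons k ks ih =>
    simp only [GG]
    refine Finset.sum_congr rfl fun i hi => ?_
    rw [Finset.mem_Icc] at hi
    rw [ih (i - 1) fun x hx => h x (by omega)]

theorem GG_add (m : ℕ) (ks : List ℕ) (f g : ℕ → ℚ) :
    GG m ks (fun x => f x + g x) = GG m ks f + GG m ks g := by
  induction ks generalizing m with
  | nil => rfl
  | cons k ks ih => simp only [GG, ih, mul_add, Finset.sum_add_distrib]

theorem GG_mul (m : ℕ) (ks : List ℕ) (c : ℚ) (f : ℕ → ℚ) :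
    GG m ks (fun x => c * f x) = c * GG m ks f := by
  induction ks generalizing m with
  | nil => rfl
  | cons k ks ih =>
    simp only [GG, ih, Finset.mul_sum]
    exact Finset.sum_congr rfl fun i _ => by ring

theorem GG_zero (m : ℕ) (ks : List ℕ) : GG m ks (fun _ => 0) = 0 := by
  have := GG_mul m ks 0 (fun _ => 0)
  simpa using this

theorem GG_sub (m : ℕ) (ks : List ℕ) (f g : ℕ → ℚ) :
    GG m ks (fun x => f x - g x) = GG m ks f - GG m ks g := by
  have h := GG_add m ks f (fun x => (-1) * g x)
  rw [GG_mul] at h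
  rw [sub_eq_add_neg, ← neg_one_mul, ← h]
  exact GG_congr _ _ _ _ fun x _ => by ring

theorem GG_sum {ι : Type*} (s : Finset ι) (m : ℕ) (ks : List ℕ) (f : ι → ℕ → ℚ) :
    GG m ks (fun x => ∑ i ∈ s, f i x) = ∑ i ∈ s, GG m ks (f i) := by
  classical
  induction s using Finset.induction_on with
  | empty => simpa using GG_zero m ks
  | insert a s ha ih =>
    simp only [Finset.sum_insert ha]
    rw [GG_add, ih]

/-- The connecting sum. -/
noncomputable def TT (M : ℕ) : List ℕ → ℚ
  | [] => 0
  | k :: ks => ∑ i ∈ Finset.Icc 1 M, (1 / (i : ℚ) ^ k) *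
      GG (i - 1) ks (fun m => ∑ q ∈ Finset.range (m + 1), 1 / ((i : ℚ) - q))

noncomputable def RR (M : ℕ) (l : List ℕ) : ℚ :=
  GG M l (fun m => ∑ j ∈ Finset.Icc 1 (m + 1), 1 / ((M : ℚ) + 1 - j))

theorem pf (k : ℕ) (i q : ℚ) (hi : i ≠ 0) (hq : q ≠ 0) (hiq : i - q ≠ 0) :
    1 / i ^ (k + 1) * (1 / (i - q)) = 1 / q ^ (k + 1) * (1 / (i - q) - 1 / i)
      - ∑ s ∈ Finset.range k, 1 / i ^ (k + 1 - s) * (1 / q ^ (s + 1)) := by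
  induction k with
  | zero => simp; field_simp; ring
  | succ k ih =>
    have e : 1 / i ^ (k + 1 + 1) * (1 / (i - q)) =
        1 / q * (1 / i ^ (k + 1) * (1 / (i - q))) - 1 / i ^ (k + 1 + 1) * (1 / q) := by
      field_simp; ring
    rw [e, ih, Finset.sum_range_succ', mul_sub, Finset.mul_sum]
    have : ∀ s ∈ Finset.range k, 1 / q * (1 / i ^ (k + 1 - s) * (1 / q ^ (s + 1))) =
        1 / i ^ (k + 1 + 1 - (s + 1)) * (1 / q ^ (s + 1 + 1)) := by
      intro s _
      rw [Nat.add_sub_add_right]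
      field_simp
      ring
    rw [Finset.sum_congr rfl this]
    simp only [Nat.sub_zero, zero_add, pow_one]
    have e2 : 1 / q * (1 / q ^ (k + 1) * (1 / (i - q) - 1 / i)) =
      1 / q ^ (k + 1 + 1) * (1 / (i - q) - 1 / i) := by
      rw [← mul_assoc]; congr 1; field_simp; ring
    rw [e2]; ring

theorem tele (m q M : ℕ) (hq : q ≤ m) (hM : m ≤ M) :
    ∑ i ∈ Finset.Ioc m M, (1 / ((i : ℚ) - q) - 1 / i) =
      ∑ j ∈ Finset.range q, 1 / ((m : ℚ) - j) - ∑ j ∈ Finset.Icc 1 q, 1 / ((M : ℚ) + 1 - j) := by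
  have e : ∀ q : ℕ, ∑ j ∈ Finset.Icc 1 q, 1 / ((M : ℚ) + 1 - j) =
      ∑ j ∈ Finset.range q, 1 / ((M : ℚ) - j) := by
    intro q
    induction q with
    | zero => simp
    | succ q ih =>
      rw [Finset.sum_Icc_succ_top (by omega), ih, Finset.sum_range_succ]
      congr 2; push_cast; ring
  rw [e]
  clear e
  induction M, hM using Nat.le_induction with
  | base => simp
  | succ M hM ih =>
    rw [← Finset.insert_Ioc_right_eq_Ioc_add_one (by omega), Finset.sum_insert (by simp), ih]
    have h := Finset.sum_range_succ (fun j : ℕ => 1 / (((M + 1 : ℕ) : ℚ) - j)) q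
    rw [Finset.sum_range_succ'] at h
    have h2 : ∑ j ∈ Finset.range q, 1 / (((M + 1 : ℕ) : ℚ) - ((j + 1 : ℕ) : ℚ)) =
        ∑ j ∈ Finset.range q, 1 / ((M : ℚ) - j) :=
      Finset.sum_congr rfl fun j _ => by congr 1; push_cast; ring
    rw [h2] at h
    simp only [Nat.cast_zero, sub_zero] at h
    linarith

theorem tri (M : ℕ) (F : ℕ → ℕ → ℚ) :
    ∑ i ∈ Finset.Icc 1 M, ∑ m ∈ Finset.Icc 1 (i - 1), F i m =
      ∑ m ∈ Finset.Icc 1 M, ∑ i ∈ Finset.Ioc m M, F i m := by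
  refine Finset.sum_comm' fun i m => ?_
  simp only [Finset.mem_Icc, Finset.mem_Ioc]
  omega

/-- The transported middle sum. -/
theorem mid (M a : ℕ) (ks : List ℕ) :
    ∑ i ∈ Finset.Icc 1 M, GG (i - 1) ks (fun m => ∑ q ∈ Finset.Icc 1 m,
      1 / (q : ℚ) ^ a * (1 / ((i : ℚ) - q) - 1 / i)) =
    TT M (ks ++ [a]) - RR M (ks ++ [a]) := by
  cases ks with
  | nil =>
    simp only [GG, List.nil_append, TT, RR]
    rw [tri, ← Finset.sum_sub_distrib]
    refine Finset.sum_congr rfl fun q hq => ?_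
    rw [Finset.mem_Icc] at hq
    rw [← Finset.mul_sum, tele q q M le_rfl hq.2, Nat.sub_add_cancel hq.1, mul_sub]
  | cons b ks =>
    simp only [GG, List.cons_append, TT, RR]
    rw [tri, ← Finset.sum_sub_distrib]
    refine Finset.sum_congr rfl fun m hm => ?_
    rw [Finset.mem_Icc] at hm
    rw [← Finset.mul_sum, ← mul_sub, ← GG_sum, ← GG_sub, GG_append]
    congr 1
    refine GG_congr _ _ _ _ fun x hx => ?_
    simp only [GG]
    rw [Finset.sum_comm]
    refine Finset.sum_congr rfl fun q hq => ?_
    rw [Finset.mem_Icc] at hq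
    rw [← Finset.mul_sum, tele m q M (by omega) hm.2, Nat.sub_add_cancel hq.1]

theorem key (M a : ℕ) (ks : List ℕ) :
    TT M ((a + 1) :: ks) = H M ((a + 2) :: ks)
      - ∑ s ∈ Finset.range a, H M ((a + 1 - s) :: (ks ++ [s + 1]))
      + TT M (ks ++ [a + 1]) - RR M (ks ++ [a + 1]) := by
  rw [add_sub_assoc, ← mid]
  have h1 : ∑ s ∈ Finset.range a, H M ((a + 1 - s) :: (ks ++ [s + 1])) =
      ∑ i ∈ Finset.Icc 1 M, GG (i - 1) ks (fun m => ∑ q ∈ Finset.Icc 1 m,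
        ∑ s ∈ Finset.range a, 1 / (i : ℚ) ^ (a + 1 - s) * (1 / (q : ℚ) ^ (s + 1))) := by
    simp only [H, H_append]
    rw [Finset.sum_comm]
    refine Finset.sum_congr rfl fun i hi => ?_
    simp only [← GG_mul, ← GG_sum]
    refine GG_congr _ _ _ _ fun x hx => ?_
    rw [Finset.sum_comm]
    refine Finset.sum_congr rfl fun s _ => ?_
    simp [Finset.mul_sum]
  have h2 : H M ((a + 2) :: ks) = ∑ i ∈ Finset.Icc 1 M, GG (i - 1) ks
      (fun _ => 1 / (i : ℚ) ^ (a + 1) * (1 / i)) := by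
    have hH : ∀ m, H m ks = GG m ks (fun _ => 1) := by
      intro m
      have := H_append m ks []
      simpa [H] using this
    simp only [H, hH]
    refine Finset.sum_congr rfl fun i hi => ?_
    rw [← GG_mul]
    refine GG_congr _ _ _ _ fun x hx => ?_
    rw [pow_succ (i : ℚ) (a + 1), mul_one, one_div_mul_one_div]
  rw [h1, h2, ← Finset.sum_sub_distrib, ← Finset.sum_add_distrib]
  simp only [TT]
  refine Finset.sum_congr rfl fun i hi => ?_
  rw [Finset.mem_Icc] at hi
  rw [← GG_mul, ← GG_sub, ← GG_add]
  refine GG_congr _ _ _ _ fun x hx => ?_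
  have hr : ∑ q ∈ Finset.range (x + 1), 1 / ((i : ℚ) - q) =
      1 / (i : ℚ) + ∑ q ∈ Finset.Icc 1 x, 1 / ((i : ℚ) - q) := by
    rw [Finset.range_eq_Ico, Finset.sum_eq_sum_Ico_succ_bot (by omega)]
    simp
    rfl
  rw [hr, mul_add, sub_add, sub_eq_add_neg, neg_sub, ← Finset.sum_sub_distrib, Finset.mul_sum]
  congr 1
  refine Finset.sum_congr rfl fun q hq => ?_
  rw [Finset.mem_Icc] at hq
  have hlt : (q : ℚ) < i := by exact_mod_cast (show q < i by omega)
  have hq0 : (0 : ℚ) < q := by exact_mod_cast hq.1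
  exact pf a i q (by linarith) (by linarith) (by linarith)

theorem orbit_sum (k : List ℕ) (hne : k ≠ []) (F : List ℕ → ℚ) :
    ∑ k' ∈ cycOrbit k, F (k'.rotate 1) = ∑ k' ∈ cycOrbit k, F k' := by
  classical
  have himg : (cycOrbit k).image (fun l => l.rotate 1) = cycOrbit k := by
    apply Finset.eq_of_subset_of_card_le
    · intro x hx
      simp only [cycOrbit, Finset.mem_image, Finset.mem_range] at hx ⊢
      obtain ⟨y, ⟨j, hj, rfl⟩, rfl⟩ := hx
      refine ⟨(j + 1) % k.length, Nat.mod_lt _ (List.length_pos_of_ne_nil hne), ?_⟩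
      rw [List.rotate_rotate, List.rotate_mod]
    · rw [Finset.card_image_of_injective _ (List.rotate_injective 1)]
  conv_rhs => rw [← himg]
  rw [Finset.sum_image fun x _ y _ h => List.rotate_injective 1 h]

/-- p-integrality -/
def PInt (p : ℕ) (x : ℚ) : Prop := ∃ a b : ℤ, ¬ ((p : ℤ) ∣ b) ∧ x * b = a

theorem PInt.add {p : ℕ} (hp : p.Prime) {x y : ℚ} (hx : PInt p x) (hy : PInt p y) :
    PInt p (x + y) := by
  obtain ⟨a, b, hb, h⟩ := hx
  obtain ⟨c, d, hd, h'⟩ := hy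
  refine ⟨a * d + c * b, b * d, ?_, ?_⟩
  · intro hh
    rcases (Nat.prime_iff_prime_int.mp hp).dvd_or_dvd hh with h | h <;> contradiction
  · push_cast
    rw [← h, ← h']; ring

theorem PInt.mul {p : ℕ} (hp : p.Prime) {x y : ℚ} (hx : PInt p x) (hy : PInt p y) :
    PInt p (x * y) := by
  obtain ⟨a, b, hb, h⟩ := hx
  obtain ⟨c, d, hd, h'⟩ := hy
  refine ⟨a * c, b * d, ?_, ?_⟩
  · intro hh
    rcases (Nat.prime_iff_prime_int.mp hp).dvd_or_dvd hh with h | h <;> contradiction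
  · push_cast
    rw [← h, ← h']; ring

theorem PInt.int {p : ℕ} (hp : p.Prime) (a : ℤ) : PInt p a :=
  ⟨a, 1, (Nat.prime_iff_prime_int.mp hp).not_dvd_one, by simp⟩

theorem PInt.sum {p : ℕ} (hp : p.Prime) {ι : Type*} (s : Finset ι) (f : ι → ℚ)
    (h : ∀ i ∈ s, PInt p (f i)) : PInt p (∑ i ∈ s, f i) :=
  Finset.sum_induction f (PInt p) (fun _ _ => PInt.add hp) (by simpa using PInt.int hp 0) h

theorem PInt.inv {p : ℕ} (hp : p.Prime) (i k : ℕ) (h1 : 1 ≤ i) (h2 : i < p) :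
    PInt p (1 / (i : ℚ) ^ k) := by
  refine ⟨1, (i : ℤ) ^ k, ?_, ?_⟩
  · intro h
    have := (Nat.prime_iff_prime_int.mp hp).dvd_of_dvd_pow h
    have := Nat.le_of_dvd h1 (Int.natCast_dvd_natCast.mp this)
    omega
  · have : (i : ℚ) ≠ 0 := by exact_mod_cast (show i ≠ 0 by omega)
    push_cast
    field_simp

theorem PInt.GG {p : ℕ} (hp : p.Prime) (m : ℕ) (hm : m < p) (ks : List ℕ) (f : ℕ → ℚ)
    (h : ∀ x ≤ m, PInt p (f x)) : PInt p (GG m ks f) := by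
  induction ks generalizing m with
  | nil => exact h m le_rfl
  | cons k ks ih =>
    refine PInt.sum hp _ _ fun i hi => ?_
    rw [Finset.mem_Icc] at hi
    exact PInt.mul hp (PInt.inv hp i k hi.1 (by omega))
      (ih (i - 1) (by omega) fun x hx => h x (by omega))

theorem geo (n : ℕ) (p j : ℚ) (hj : j ≠ 0) (hpj : p - j ≠ 0) :
    ∑ l ∈ Finset.range n, p ^ l * (1 / j ^ (l + 1)) + 1 / (p - j) =
      p ^ n * (1 / j ^ n * (1 / (p - j))) := by
  induction n with
  | zero => simp
  | succ n ih =>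
    rw [Finset.sum_range_succ, add_right_comm, ih]
    field_simp
    ring

theorem third (p n : ℕ) (hp : p.Prime) (a : ℕ) (ks : List ℕ) :
    ∃ x, PInt p x ∧ ∑ l ∈ Finset.range n, (p : ℚ) ^ l *
          (H (p - 1) (ks ++ [a, l + 1]) + H (p - 1) (ks ++ [a + l + 1])) +
          RR (p - 1) (ks ++ [a]) = p ^ n * x := by
  have hp1 := hp.one_lt
  refine ⟨GG (p - 1) ks (fun m => ∑ q ∈ Finset.Icc 1 m, 1 / (q : ℚ) ^ a *
    ∑ j ∈ Finset.Icc 1 q, (1 / (j : ℚ) ^ n * (1 / ((p : ℚ) - j)))), ?_, ?_⟩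
  · refine PInt.GG hp _ (by omega) _ _ fun x hx => ?_
    refine PInt.sum hp _ _ fun q hq => ?_
    rw [Finset.mem_Icc] at hq
    refine PInt.mul hp (PInt.inv hp q a hq.1 (by omega)) ?_
    refine PInt.sum hp _ _ fun j hj => ?_
    rw [Finset.mem_Icc] at hj
    refine PInt.mul hp (PInt.inv hp j n hj.1 (by omega)) ?_
    have := PInt.inv hp (p - j) 1 (by omega) (by omega)
    rwa [pow_one, Nat.cast_sub (by omega)] at this
  · rw [← GG_mul]
    unfold RR
    simp only [H_append, GG_append, ← GG_add, ← GG_mul, ← GG_sum]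
    refine GG_congr _ _ _ _ fun x hx => ?_
    simp only [H, GG, mul_one]
    simp only [← Finset.sum_add_distrib, Finset.mul_sum (s := Finset.Icc 1 x)]
    rw [Finset.sum_comm, ← Finset.sum_add_distrib]
    refine Finset.sum_congr rfl fun q hq => ?_
    rw [Finset.mem_Icc] at hq
    have hM : ((p - 1 : ℕ) : ℚ) + 1 = p := by
      rw [Nat.cast_sub (by omega)]; simp
    rw [hM, Nat.sub_add_cancel hq.1, mul_left_comm, Finset.mul_sum (s := Finset.Icc 1 q) (a := (p : ℚ) ^ n)]
    have hg : ∀ j ∈ Finset.Icc 1 q, (p : ℚ) ^ n * (1 / (j : ℚ) ^ n * (1 / ((p : ℚ) - j))) =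
        ∑ l ∈ Finset.range n, (p : ℚ) ^ l * (1 / (j : ℚ) ^ (l + 1)) + 1 / ((p : ℚ) - j) := by
      intro j hj
      rw [Finset.mem_Icc] at hj
      have h1 : (0 : ℚ) < j := by exact_mod_cast hj.1
      have h2 : (j : ℚ) < p := by exact_mod_cast (show j < p by omega)
      exact (geo n p j (by linarith) (by linarith)).symm
    rw [Finset.sum_congr rfl hg, Finset.sum_add_distrib, mul_add, Finset.sum_comm]
    congr 1
    rw [Finset.mul_sum]
    refine Finset.sum_congr rfl fun l _ => ?_
    obtain ⟨r, rfl⟩ : ∃ r, q = r + 1 := ⟨q - 1, by omega⟩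
    rw [← Finset.mul_sum, Finset.sum_Icc_succ_top (by omega), Nat.add_sub_cancel, add_assoc a l 1,
      pow_add _ a (l + 1), ← one_div_mul_one_div]
    ring

theorem stmt8 (p : ℕ) (hp : p.Prime) (n : ℕ) (hn : 1 ≤ n)
    (k : List ℕ) (hk : ∀ x ∈ k, 1 ≤ x) (hne : k ≠ []) :
    ∃ a b : ℤ, ¬ ((p : ℤ) ∣ b) ∧
      ((∑ k' ∈ cycOrbit k, ∑ s ∈ Finset.range (k'.headI - 1),
          H (p - 1) ((k'.headI - s) :: (k'.tail ++ [s + 1]))) -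
        (∑ k' ∈ cycOrbit k, H (p - 1) ((k'.headI + 1) :: k'.tail)) -
        ∑ k' ∈ cycOrbit k, ∑ l ∈ Finset.range n, (p : ℚ) ^ l *
          (H (p - 1) (k'.tail ++ [k'.headI, l + 1]) +
            H (p - 1) (k'.tail ++ [k'.headI + l + 1]))) * b = p ^ n * a := by
  choose x hx hx' using fun k' : List ℕ => third p n hp k'.headI k'.tail
  have hT := orbit_sum k hne (TT (p - 1))
  have hkey : ∀ k' ∈ cycOrbit k, TT (p - 1) k' = H (p - 1) ((k'.headI + 1) :: k'.tail)
      - ∑ s ∈ Finset.range (k'.headI - 1), H (p - 1) ((k'.headI - s) :: (k'.tail ++ [s + 1]))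
      + TT (p - 1) (k'.rotate 1) - RR (p - 1) (k'.tail ++ [k'.headI]) := by
    intro k' hk'
    simp only [cycOrbit, Finset.mem_image] at hk'
    obtain ⟨j, _, rfl⟩ := hk'
    have h1 : ∀ y ∈ k.rotate j, 1 ≤ y := fun y hy => hk y (List.mem_rotate.mp hy)
    have h2 : k.rotate j ≠ [] := by simpa using hne
    generalize k.rotate j = l at h1 h2
    match l, h1, h2 with
    | a :: ks, h1, _ =>
      obtain ⟨b, rfl⟩ : ∃ b, a = b + 1 := ⟨a - 1, by have := h1 a (by simp); omega⟩
      simpa using key (p - 1) b ks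
  have hS := Finset.sum_congr rfl hkey
  simp only [Finset.sum_sub_distrib, Finset.sum_add_distrib] at hS
  have hX := Finset.sum_congr (rfl : cycOrbit k = cycOrbit k) fun k' _ => hx' k'
  rw [Finset.sum_add_distrib, ← Finset.mul_sum] at hX
  obtain ⟨a, b, hb, hab⟩ := PInt.sum hp (cycOrbit k) x fun k' _ => hx k'
  refine ⟨-a, b, hb, ?_⟩
  push_cast
  rw [← hab]
  linear_combination (-(b : ℚ)) * hX + (b : ℚ) * hS + (b : ℚ) * hT
end

section
/- Let p be a prime and n ≥ 1. Then in ℚ(q): H_{p−1}((1); q) − ((p−1)/2)·(1 − q) + (1/2) · Σ_{l=1}^{n−1} [p]^l · H̄_{p−1}((1+l); q) ≡ 0 (mod [p]^n), where the sum over l is empty when n = 1. -/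
open Finset

/-- `[N] = 1 + q + ⋯ + q^{N-1}` in `ℚ[q]`. -/
noncomputable def qiP (N : ℕ) : Polynomial ℚ := ∑ i ∈ Finset.range N, Polynomial.X ^ i

/-- `[N] = 1 + q + ⋯ + q^{N-1}` in `ℚ(q)`. -/
noncomputable def qiR (N : ℕ) : RatFunc ℚ := ∑ i ∈ Finset.range N, RatFunc.X ^ i

/-- `A ≡ B (mod [p]^n)` in `ℚ(q)`:  `A − B = [p]^n f/g` with `f, g ∈ ℚ[q]`, `[p] ∤ g`. -/
def CongMod (p n : ℕ) (A B : RatFunc ℚ) : Prop :=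
  ∃ f g : Polynomial ℚ, ¬ (qiP p ∣ g) ∧
    A - B = (algebraMap (Polynomial ℚ) (RatFunc ℚ) (qiP p)) ^ n *
      (algebraMap (Polynomial ℚ) (RatFunc ℚ) f / algebraMap (Polynomial ℚ) (RatFunc ℚ) g)

/-- `H_{p−1}((1); q) = Σ_{m=1}^{p−1} 1/[m]`. -/
noncomputable def H1 (p : ℕ) : RatFunc ℚ := ∑ m ∈ Finset.Icc 1 (p - 1), 1 / qiR m

/-- `H̄_{p−1}((s); q) = Σ_{m=1}^{p−1} q^m/[m]^s`. -/
noncomputable def Hbar1 (p s : ℕ) : RatFunc ℚ :=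
  ∑ m ∈ Finset.Icc 1 (p - 1), RatFunc.X ^ m / qiR m ^ s

lemma qiP_map (N : ℕ) : algebraMap (Polynomial ℚ) (RatFunc ℚ) (qiP N) = qiR N := by
  simp [qiP, qiR, map_sum]

lemma qiP_prime (p : ℕ) (hp : p.Prime) : Prime (qiP p) := by
  have := Fact.mk hp
  have h := Polynomial.cyclotomic.irreducible_rat hp.pos
  rw [Polynomial.cyclotomic_prime] at h
  exact h.prime

lemma qiP_natDegree (m : ℕ) : (qiP (m + 1)).natDegree = m ∧ qiP (m + 1) ≠ 0 := by
  have hm : (qiP (m + 1)).Monic := Polynomial.Monic.geom_sum' Polynomial.monic_X (by simp) (by simp)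
  refine ⟨?_, hm.ne_zero⟩
  have h : qiP (m + 1) * (Polynomial.X - 1) = Polynomial.X ^ (m + 1) - 1 := geom_sum_mul _ _
  have h2 := congrArg Polynomial.natDegree h
  have hX : (Polynomial.X - 1 : Polynomial ℚ).Monic := by
    simpa using Polynomial.monic_X_sub_C (1 : ℚ)
  rw [hm.natDegree_mul hX] at h2
  have e1 : (Polynomial.X - 1 : Polynomial ℚ).natDegree = 1 := by
    simpa using Polynomial.natDegree_X_sub_C (1 : ℚ)
  have e2 : (Polynomial.X ^ (m + 1) - 1 : Polynomial ℚ).natDegree = m + 1 := by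
    simpa using Polynomial.natDegree_X_pow_sub_C (n := m + 1) (r := (1 : ℚ))
  omega

lemma qiP_not_dvd (p m : ℕ) (hm : 1 ≤ m) (hmp : m < p) : ¬ qiP p ∣ qiP m := by
  obtain ⟨a, rfl⟩ : ∃ a, m = a + 1 := ⟨m - 1, by omega⟩
  obtain ⟨b, rfl⟩ : ∃ b, p = b + 1 := ⟨p - 1, by omega⟩
  intro h
  have := Polynomial.natDegree_le_of_dvd h (qiP_natDegree a).2
  rw [(qiP_natDegree a).1, (qiP_natDegree b).1] at this
  omega

lemma qiR_ne (m : ℕ) (hm : 1 ≤ m) : qiR m ≠ 0 := by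
  obtain ⟨a, rfl⟩ : ∃ a, m = a + 1 := ⟨m - 1, by omega⟩
  rw [← qiP_map]
  exact RatFunc.algebraMap_ne_zero (qiP_natDegree a).2

lemma qiR_add (p m : ℕ) (h : m ≤ p) : qiR p = qiR m + RatFunc.X ^ m * qiR (p - m) := by
  obtain ⟨k, rfl⟩ := Nat.exists_eq_add_of_le h
  simp [qiR, Finset.sum_range_add, Finset.mul_sum, pow_add]

lemma qiR_one_sub (m : ℕ) : (1 - RatFunc.X) * qiR m = 1 - RatFunc.X ^ m :=
  mul_neg_geom_sum _ _

lemma sum_frac (p : ℕ) (hp : p.Prime) (s : Finset ℕ) (F : ℕ → RatFunc ℚ)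
    (hF : ∀ m ∈ s, ∃ f g : Polynomial ℚ, ¬ (qiP p ∣ g) ∧
      F m = algebraMap (Polynomial ℚ) (RatFunc ℚ) f / algebraMap (Polynomial ℚ) (RatFunc ℚ) g) :
    ∃ f g : Polynomial ℚ, ¬ (qiP p ∣ g) ∧
      ∑ m ∈ s, F m =
        algebraMap (Polynomial ℚ) (RatFunc ℚ) f / algebraMap (Polynomial ℚ) (RatFunc ℚ) g := by
  classical
  induction s using Finset.induction_on with
  | empty => exact ⟨0, 1, fun h => (qiP_prime p hp).not_isUnit (isUnit_of_dvd_one h), by simp⟩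
  | insert a s ha ih =>
    obtain ⟨f, g, hg, e⟩ := ih fun m hm => hF m (Finset.mem_insert_of_mem hm)
    obtain ⟨f', g', hg', e'⟩ := hF a (Finset.mem_insert_self _ _)
    refine ⟨f' * g + g' * f, g' * g, fun h => ((qiP_prime p hp).dvd_or_dvd h).elim hg' hg, ?_⟩
    have n1 : algebraMap (Polynomial ℚ) (RatFunc ℚ) g ≠ 0 :=
      RatFunc.algebraMap_ne_zero fun h => hg (h ▸ dvd_zero _)
    have n2 : algebraMap (Polynomial ℚ) (RatFunc ℚ) g' ≠ 0 :=
      RatFunc.algebraMap_ne_zero fun h => hg' (h ▸ dvd_zero _)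
    rw [Finset.sum_insert ha, e, e', div_add_div _ _ n2 n1]
    simp only [map_add, map_mul]

/-- the geometric expansion of `1/[p-m]` -/
lemma key_s11 (p n m : ℕ) (hm : 1 ≤ m) (hmp : m < p) :
    1 / qiR (p - m) + ∑ l ∈ range n, qiR p ^ l * (RatFunc.X ^ m / qiR m ^ (1 + l)) =
      qiR p ^ n * (1 / (qiR m ^ n * qiR (p - m))) := by
  have h1 := qiR_ne m hm
  have h2 := qiR_ne (p - m) (by omega)
  have h := qiR_add p m hmp.le
  induction n with
  | zero => simp
  | succ n ih =>
    rw [Finset.sum_range_succ, ← add_assoc, ih]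
    have : qiR p ^ (n + 1) = qiR p ^ n * (qiR m + RatFunc.X ^ m * qiR (p - m)) := by
      rw [pow_succ, ← h]
    rw [this]
    field_simp
    ring

theorem stmt11 (p : ℕ) (hp : p.Prime) (n : ℕ) (hn : 1 ≤ n) :
    CongMod p n
      (H1 p - (((p : RatFunc ℚ) - 1) / 2) * (1 - RatFunc.X) +
        (1 / 2) * ∑ l ∈ Finset.Icc 1 (n - 1), qiR p ^ l * Hbar1 p (1 + l))
      0 := by
  obtain ⟨f, g, hg, e⟩ := sum_frac p hp (Icc 1 (p - 1))
    (fun m => 1 / (qiR m ^ n * qiR (p - m))) (fun m hm => by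
      rw [mem_Icc] at hm
      refine ⟨1, qiP m ^ n * qiP (p - m), fun h => ?_, by simp [qiP_map]⟩
      rcases (qiP_prime p hp).dvd_or_dvd h with h | h
      · exact qiP_not_dvd p m hm.1 (by omega) ((qiP_prime p hp).dvd_of_dvd_pow h)
      · exact qiP_not_dvd p (p - m) (by omega) (by omega) h)
  refine ⟨Polynomial.C (1 / 2) * f, g, hg, ?_⟩
  have hrefl : ∑ m ∈ Icc 1 (p - 1), 1 / qiR (p - m) = H1 p := by
    unfold H1
    refine Finset.sum_bij' (fun m _ => p - m) (fun m _ => p - m) ?_ ?_ ?_ ?_ ?_ <;>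
      intro m hm <;> simp only [mem_Icc] at * <;> first | omega | rfl
  have hzero : ∑ m ∈ Icc 1 (p - 1), RatFunc.X ^ m / qiR m =
      H1 p - ((p : RatFunc ℚ) - 1) * (1 - RatFunc.X) := by
    have : ∀ m ∈ Icc 1 (p - 1), RatFunc.X ^ m / qiR m = 1 / qiR m - (1 - RatFunc.X) := by
      intro m hm
      rw [mem_Icc] at hm
      have h1 := qiR_ne m hm.1
      have h2 := qiR_one_sub m
      field_simp
      linear_combination h2
    rw [Finset.sum_congr rfl this, Finset.sum_sub_distrib, H1]
    simp [Nat.cast_sub hp.one_le]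
    ring
  have hsum := Finset.sum_congr (rfl : Icc 1 (p - 1) = Icc 1 (p - 1)) (fun m hm =>
    key_s11 p n m (mem_Icc.1 hm).1 (by have := mem_Icc.1 hm; omega))
  rw [Finset.sum_add_distrib, hrefl, Finset.sum_comm, ← Finset.mul_sum, e] at hsum
  obtain ⟨k, rfl⟩ : ∃ k, n = k + 1 := ⟨n - 1, by omega⟩
  have hI : ∑ l ∈ Finset.Icc 1 (k + 1 - 1), qiR p ^ l * Hbar1 p (1 + l) =
      ∑ l ∈ range k, ∑ m ∈ Icc 1 (p - 1),
        qiR p ^ (l + 1) * (RatFunc.X ^ m / qiR m ^ (1 + (l + 1))) := by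
    rw [Nat.add_sub_cancel, Finset.range_eq_Ico, Finset.sum_Ico_add'
      (fun l => ∑ m ∈ Icc 1 (p - 1), qiR p ^ l * (RatFunc.X ^ m / qiR m ^ (1 + l)))]
    refine Finset.sum_congr (by rfl) fun l _ => ?_
    rw [Hbar1, Finset.mul_sum]
  rw [Finset.sum_range_succ', ← hI] at hsum
  simp only [pow_zero, one_mul, add_zero, pow_one] at hsum
  rw [hzero] at hsum
  rw [qiP_map, map_mul]
  have hc : algebraMap (Polynomial ℚ) (RatFunc ℚ) (Polynomial.C (1 / 2)) = 1 / 2 := by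
    rw [RatFunc.algebraMap_C]; simp
  rw [hc]
  linear_combination (1 / 2) * hsum
end
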